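/- arXiv:2205.08464 — 2 statements merged into one kernel-verified Lean document; each statement's English description precedes it below -/
import Mathlib

section
/- Let τ > 0. For every real number x, the Huber value ρ_τ(x) is the greatest element of the set {2·x·h − h² : h ∈ [−τ, τ]}; that is, ρ_τ(x) = max_{h ∈ [−τ,τ]} (2·x·h − h²), with the maximum attained at h = x when |x| ≤ τ and at h = τ·sign(x) otherwise. -/
/-- The Huber function with threshold `τ`. -/
noncomputable def huber (τ a : ℝ) : ℝ :=
  if |a| ≤ τ then a ^ 2 else 2 * τ * |a| - τ ^ 2

theorem two_mul_mul_sub_sq_le_huber {τ x h : ℝ} (hh : h ∈ Set.Icc (-τ) τ) :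
    2 * x * h - h ^ 2 ≤ huber τ x := by
  obtain ⟨hl, hu⟩ := hh
  unfold huber
  split_ifs with hx
  · nlinarith [sq_nonneg (x - h)]
  · rw [not_le] at hx
    rcases abs_cases x with ⟨hax, _⟩ | ⟨hax, _⟩ <;> rw [hax] at hx ⊢
    · nlinarith [mul_nonneg (sub_nonneg.2 hu) (sub_nonneg.2 hx.le), sq_nonneg (τ - h)]
    · nlinarith [mul_nonneg (neg_le_iff_add_nonneg.1 hl) (sub_nonneg.2 hx.le),
        sq_nonneg (τ + h)]

/-- Biconjugate of the Huber function: for `τ > 0` and every real `x`, `ρ_τ(x)` is the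
greatest element of `{2xh − h² : h ∈ [−τ, τ]}`, attained at `h = x` when `|x| ≤ τ` and
at `h = τ · sign x` otherwise. -/
theorem huber_biconjugate (τ : ℝ) (hτ : 0 < τ) (x : ℝ) :
    IsGreatest ((fun h : ℝ => 2 * x * h - h ^ 2) '' Set.Icc (-τ) τ) (huber τ x) ∧
      (let h₀ : ℝ := if |x| ≤ τ then x else τ * Real.sign x
       h₀ ∈ Set.Icc (-τ) τ ∧ 2 * x * h₀ - h₀ ^ 2 = huber τ x) := by
  have key : (if |x| ≤ τ then x else τ * Real.sign x) ∈ Set.Icc (-τ) τ ∧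
      2 * x * (if |x| ≤ τ then x else τ * Real.sign x) -
        (if |x| ≤ τ then x else τ * Real.sign x) ^ 2 = huber τ x := by
    unfold huber
    split_ifs with hx
    · exact ⟨abs_le.1 hx, by ring⟩
    · have hx0 : x ≠ 0 := by
        rintro rfl
        simp [hτ.le] at hx
      rcases hx0.lt_or_gt with h | h
      · rw [Real.sign_of_neg h, abs_of_neg h]
        exact ⟨⟨by linarith, by linarith⟩, by ring⟩
      · rw [Real.sign_of_pos h, abs_of_pos h]
        exact ⟨⟨by linarith, by linarith⟩, by ring⟩
  refine ⟨⟨⟨_, key.1, key.2⟩, ?_⟩, key⟩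
  rintro _ ⟨h, hh, rfl⟩
  exact two_mul_mul_sub_sq_le_huber hh
end

section
/- Let τ > 0, set τ_cap = min(τ, 1), and let ε be a real number with 0 < ε ≤ τ_cap². Then for every real number a, |a| ≤ (√ε / (2ε)) · ρ_τ(a) + √ε / 2. -/
/-- Pointwise Huber bound on the absolute value: for `τ > 0`, `τ_cap = min(τ,1)`,
`0 < ε ≤ τ_cap²`, and every real `a`, `|a| ≤ (√ε / (2ε)) · ρ_τ(a) + √ε / 2`. -/
theorem abs_le_huber (τ : ℝ) (hτ : 0 < τ) (ε : ℝ)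
    (hε : 0 < ε) (hε' : ε ≤ (min τ 1) ^ 2) (a : ℝ) :
    |a| ≤ Real.sqrt ε / (2 * ε) * huber τ a + Real.sqrt ε / 2 := by
  have hs : 0 < √ε := Real.sqrt_pos.mpr hε
  have hsτ : √ε ≤ τ :=
    (Real.sqrt_le_left (le_min hτ.le zero_le_one)).mpr hε' |>.trans (min_le_left τ 1)
  have key : 2 * √ε * |a| ≤ huber τ a + √ε ^ 2 := by
    unfold huber
    split_ifs with h
    · nlinarith [sq_nonneg (|a| - √ε), sq_abs a]
    · nlinarith [mul_nonneg (sub_nonneg.mpr hsτ) (show 0 ≤ 2 * |a| - (τ + √ε) by linarith)]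
  calc |a| = 2 * √ε * |a| / (2 * √ε) := by field_simp
    _ ≤ (huber τ a + √ε ^ 2) / (2 * √ε) := by gcongr
    _ = √ε / (2 * √ε ^ 2) * huber τ a + √ε / 2 := by field_simp
    _ = √ε / (2 * ε) * huber τ a + √ε / 2 := by rw [Real.sq_sqrt hε.le]
end
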